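/- arXiv:2506.19830 — 14 statements merged into one kernel-verified Lean document; each statement's English description precedes it below -/
import Mathlib

section
/- Let 0 < α < 1 and let γ ≥ 1 be a natural number. Then ∑'_{k ∈ ℕ} ⌈(k+1)/γ⌉ · α^k · (1−α) = 1/(1 − α^γ). -/
theorem ceil_aux (γ : ℕ) (hγ : 1 ≤ γ) (k : ℕ) :
    ⌈((k : ℚ) + 1) / (γ : ℚ)⌉ = ((k / γ + 1 : ℕ) : ℤ) := by
  have hg : (0 : ℚ) < γ := by exact_mod_cast hγ
  have h1 : γ * (k / γ) + k % γ = k := Nat.div_add_mod k γ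
  have h2 : k % γ < γ := Nat.mod_lt _ hγ
  generalize k / γ = q at *
  rw [Int.ceil_eq_iff]
  constructor
  · rw [lt_div_iff₀ hg]
    have : q * γ < k + 1 := by rw [mul_comm]; omega
    have h : ((q : ℚ)) * γ < k + 1 := by exact_mod_cast this
    push_cast at h ⊢
    linarith
  · rw [div_le_iff₀ hg]
    have : k + 1 ≤ (q + 1) * γ := by
      rw [add_mul, mul_comm]; omega
    exact_mod_cast this

/-- Expectation of ⌈(X+1)/γ⌉ for a geometric random variable X. -/
theorem stmt_1 (α : ℝ) (hα0 : 0 < α) (hα1 : α < 1) (γ : ℕ) (hγ : 1 ≤ γ) :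
    (∑' k : ℕ, ((⌈((k : ℚ) + 1) / (γ : ℚ)⌉ : ℤ) : ℝ) * α ^ k * (1 - α)) =
      1 / (1 - α ^ γ) := by
  simp only [ceil_aux γ hγ, Int.cast_natCast]
  rw [tsum_mul_right]
  have hgeo : Summable (fun k : ℕ => α ^ k) := summable_geometric_of_lt_one hα0.le hα1
  have hsum : Summable (fun k : ℕ => ((k / γ + 1 : ℕ) : ℝ) * α ^ k) := by
    have h1 : Summable (fun k : ℕ => (k : ℝ) ^ 1 * α ^ k) :=
      summable_pow_mul_geometric_of_norm_lt_one 1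
        (by rw [Real.norm_eq_abs, abs_of_pos hα0]; exact hα1)
    refine Summable.of_nonneg_of_le (fun k => by positivity) (fun k => ?_) (h1.add hgeo)
    have : ((k / γ : ℕ) : ℝ) ≤ k := by exact_mod_cast Nat.div_le_self k γ
    have hp : 0 < α ^ k := by positivity
    push_cast
    nlinarith
  have hS := hsum.sum_add_tsum_nat_add γ
  have hshift : ∀ k : ℕ, (((k + γ) / γ + 1 : ℕ) : ℝ) * α ^ (k + γ)
      = α ^ γ * (((k / γ + 1 : ℕ) : ℝ) * α ^ k + α ^ k) := by
    intro k
    rw [Nat.add_div_right k hγ, pow_add]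
    push_cast
    ring
  simp only [hshift] at hS
  rw [tsum_mul_left, hsum.tsum_add hgeo, tsum_geometric_of_lt_one hα0.le hα1] at hS
  have hfin : ∑ k ∈ Finset.range γ, ((k / γ + 1 : ℕ) : ℝ) * α ^ k
      = ∑ k ∈ Finset.range γ, α ^ k := by
    refine Finset.sum_congr rfl fun k hk => ?_
    rw [Nat.div_eq_of_lt (Finset.mem_range.1 hk)]
    simp
  rw [hfin] at hS
  have hg := mul_neg_geom_sum α γ
  have hpow : α ^ γ < 1 := pow_lt_one₀ hα0.le hα1 (by omega)
  generalize (∑' k : ℕ, ((k / γ + 1 : ℕ) : ℝ) * α ^ k) = S at *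
  generalize (∑ k ∈ Finset.range γ, α ^ k) = T at *
  rw [eq_div_iff (by linarith)]
  have hi : (1 - α) * (1 - α)⁻¹ = 1 := mul_inv_cancel₀ (by linarith)
  linear_combination (-(1 - α)) * hS + hg + α ^ γ * hi
end

section
/- Let 0 < α < 1 and let γ ≥ 1 be a natural number. Then ∑'_{k ∈ ℕ} (k mod γ) · α^k · (1−α) = (α − α^{γ+1} − γ·(1−α)·α^γ) / ((1−α)·(1 − α^γ)). -/
theorem fin_aux (α : ℝ) (n : ℕ) :
    (∑ k ∈ Finset.range n, (k : ℝ) * α ^ k * (1 - α)) * (1 - α) =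
      α - α ^ (n + 1) - (n : ℝ) * (1 - α) * α ^ n := by
  induction n with
  | zero => simp
  | succ n ih =>
    rw [Finset.sum_range_succ, add_mul, ih]
    push_cast
    ring

/-- Expectation of X mod γ for a geometric random variable X. -/
theorem stmt_3 (α : ℝ) (hα0 : 0 < α) (hα1 : α < 1) (γ : ℕ) (hγ : 1 ≤ γ) :
    (∑' k : ℕ, ((k % γ : ℕ) : ℝ) * α ^ k * (1 - α)) =
      (α - α ^ (γ + 1) - (γ : ℝ) * (1 - α) * α ^ γ) / ((1 - α) * (1 - α ^ γ)) := by
  have h1 : 0 < 1 - α := by linarith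
  have h2 : 0 < 1 - α ^ γ := by
    have := pow_lt_one₀ hα0.le hα1 (by omega : γ ≠ 0)
    linarith
  have hs : Summable (fun k : ℕ => ((k % γ : ℕ) : ℝ) * α ^ k * (1 - α)) := by
    apply Summable.mul_right
    refine Summable.of_nonneg_of_le (fun k => by positivity) (fun k => ?_)
      ((summable_geometric_of_lt_one hα0.le hα1).mul_left (γ : ℝ))
    have : ((k % γ : ℕ) : ℝ) ≤ γ := by exact_mod_cast (Nat.mod_lt k hγ).le
    gcongr
  have key := hs.sum_add_tsum_nat_add γ
  have e1 : ∑ k ∈ Finset.range γ, ((k % γ : ℕ) : ℝ) * α ^ k * (1 - α) =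
      ∑ k ∈ Finset.range γ, (k : ℝ) * α ^ k * (1 - α) := by
    refine Finset.sum_congr rfl fun k hk => ?_
    rw [Nat.mod_eq_of_lt (Finset.mem_range.1 hk)]
  have e2 : ∑' k : ℕ, (((k + γ) % γ : ℕ) : ℝ) * α ^ (k + γ) * (1 - α) =
      α ^ γ * ∑' k : ℕ, ((k % γ : ℕ) : ℝ) * α ^ k * (1 - α) := by
    rw [← tsum_mul_left]
    refine tsum_congr fun k => ?_
    rw [Nat.add_mod_right, pow_add]
    ring
  rw [e1, e2] at key
  rw [eq_div_iff (by positivity), ← fin_aux α γ]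
  linear_combination (-(1 - α)) * key
end

section
/- Let 0 < α < 1, 0 < c < 1, and let γ ≥ 1 be a natural number. Define E₀ := ∑'_{k ∈ ℕ} k·α^k·(1−α), E₁ := ∑'_{k ∈ ℕ} ⌈(k+1)/γ⌉·α^k·(1−α), and E₂ := ∑'_{k ∈ ℕ} (k mod γ)·α^k·(1−α). Then the asymptotic speedup of asynchronous Lookahead Reasoning in the depth-limited case satisfies (1 + E₀)/(E₁ + c·E₂) = (1 − α^γ) / ((1−α) + c·(α − α^{γ+1} − γ·(1−α)·α^γ)). -/
/-- Depth-limited asymptotic speedup of asynchronous Lookahead Reasoning. -/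
theorem stmt_4 (α c : ℝ) (hα0 : 0 < α) (hα1 : α < 1) (hc0 : 0 < c) (hc1 : c < 1)
    (γ : ℕ) (hγ : 1 ≤ γ)
    (E₀ E₁ E₂ : ℝ)
    (hE₀ : E₀ = ∑' k : ℕ, (k : ℝ) * α ^ k * (1 - α))
    (hE₁ : E₁ = ∑' k : ℕ, ((⌈((k : ℚ) + 1) / (γ : ℚ)⌉ : ℤ) : ℝ) * α ^ k * (1 - α))
    (hE₂ : E₂ = ∑' k : ℕ, ((k % γ : ℕ) : ℝ) * α ^ k * (1 - α)) :
    (1 + E₀) / (E₁ + c * E₂) =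
      (1 - α ^ γ) /
        ((1 - α) + c * (α - α ^ (γ + 1) - (γ : ℝ) * (1 - α) * α ^ γ)) := by
  have hn : ‖α‖ < 1 := by rw [Real.norm_eq_abs, abs_of_pos hα0]; exact hα1
  have h1 : (1 - α) ≠ 0 := by linarith
  have hp : α ^ γ < 1 := pow_lt_one₀ hα0.le hα1 (by omega)
  have h2 : (1 - α ^ γ) ≠ 0 := by linarith
  have hG : HasSum (fun k : ℕ => α ^ k) (1 - α)⁻¹ := hasSum_geometric_of_lt_one hα0.le hα1
  have hK : HasSum (fun k : ℕ => (k : ℝ) * α ^ k) (α / (1 - α) ^ 2) :=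
    hasSum_coe_mul_geometric_of_norm_lt_one hn
  have hFs : Summable (fun k : ℕ => ((k / γ : ℕ) : ℝ) * α ^ k) := by
    refine Summable.of_nonneg_of_le (fun k => by positivity) (fun k => ?_) hK.summable
    have : ((k / γ : ℕ) : ℝ) ≤ (k : ℝ) := by exact_mod_cast Nat.div_le_self k γ
    gcongr
  obtain ⟨S, hS⟩ := hFs
  have hSeq : S = α ^ γ * (S + (1 - α)⁻¹) := by
    have e1 := hS.summable.sum_add_tsum_nat_add γ
    rw [hS.tsum_eq] at e1
    have z : ∑ i ∈ Finset.range γ, ((i / γ : ℕ) : ℝ) * α ^ i = 0 := by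
      apply Finset.sum_eq_zero
      intro i hi
      rw [Nat.div_eq_of_lt (Finset.mem_range.mp hi)]; simp
    have e2 := ((hS.add hG).mul_left (α ^ γ)).tsum_eq
    rw [z, zero_add] at e1
    refine e1.symm.trans (Eq.trans ?_ e2)
    refine tsum_congr fun k => ?_
    rw [Nat.add_div_right _ (by omega)]
    push_cast
    ring
  have hSv : S = α ^ γ / ((1 - α) * (1 - α ^ γ)) := by
    rw [eq_div_iff (mul_ne_zero h1 h2)]
    field_simp at hSeq
    linarith
  have hceil : ∀ k : ℕ, ⌈((k : ℚ) + 1) / (γ : ℚ)⌉ = ((k / γ : ℕ) : ℤ) + 1 := by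
    intro k
    have hg : (0 : ℚ) < γ := by exact_mod_cast hγ
    have hd := Nat.div_add_mod k γ
    have hm := Nat.mod_lt k (show γ > 0 by omega)
    generalize k / γ = q at hd ⊢
    generalize k % γ = r at hd hm
    rw [Int.ceil_eq_iff]
    constructor
    · rw [lt_div_iff₀ hg]
      push_cast
      have : q * γ < k + 1 := by nlinarith
      have : ((q : ℚ)) * γ < k + 1 := by exact_mod_cast this
      linarith
    · rw [div_le_iff₀ hg]
      have : k + 1 ≤ (q + 1) * γ := by nlinarith
      exact_mod_cast this
  have E0 : E₀ = α / (1 - α) ^ 2 * (1 - α) := by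
    rw [hE₀]; exact (hK.mul_right _).tsum_eq
  have E1 : E₁ = (S + (1 - α)⁻¹) * (1 - α) := by
    rw [hE₁, ← ((hS.add hG).mul_right (1 - α)).tsum_eq]
    refine tsum_congr fun k => ?_
    rw [hceil]
    generalize k / γ = q
    push_cast; ring
  have E2 : E₂ = (α / (1 - α) ^ 2 - γ * S) * (1 - α) := by
    rw [hE₂, ← ((hK.sub (hS.mul_left (γ : ℝ))).mul_right (1 - α)).tsum_eq]
    refine tsum_congr fun k => ?_
    have : (k : ℝ) = γ * ((k / γ : ℕ) : ℝ) + ((k % γ : ℕ) : ℝ) := by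
      exact_mod_cast (Nat.div_add_mod k γ).symm
    linear_combination (-(α ^ k * (1 - α))) * this
  have N : 1 + E₀ = 1 / (1 - α) := by rw [E0]; field_simp; ring
  have D : E₁ + c * E₂ = ((1 - α) + c * (α - α ^ (γ + 1) - (γ : ℝ) * (1 - α) * α ^ γ)) /
      ((1 - α) * (1 - α ^ γ)) := by
    rw [E1, E2, hSv, pow_succ]; field_simp; ring
  rw [N, D, div_div_eq_mul_div]
  congr 1
  field_simp
end

section
/- Let 0 < c < α < 1 and define g : ℝ → ℝ by g(γ) = (1 − α^γ) / ((1−α)·(1 − c + c·γ)). Then there exists a unique γ̂ ∈ [1, ∞) such that g is strictly increasing on [1, γ̂] and strictly decreasing on [γ̂, ∞). -/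
/-- Unimodality of the token-level speculative decoding speedup. -/
theorem stmt_5 (α c : ℝ) (hc0 : 0 < c) (hcα : c < α) (hα1 : α < 1)
    (g : ℝ → ℝ)
    (hg : ∀ γ : ℝ, g γ = (1 - α ^ γ) / ((1 - α) * (1 - c + c * γ))) :
    ∃! γ₀ : ℝ, 1 ≤ γ₀ ∧ StrictMonoOn g (Set.Icc 1 γ₀) ∧ StrictAntiOn g (Set.Ici γ₀) := by
  have hα0 : 0 < α := hc0.trans hcα
  obtain ⟨L, hL⟩ : ∃ L, L = -Real.log α := ⟨_, rfl⟩
  have hlog : Real.log α < α - 1 := Real.log_lt_sub_one_of_pos hα0 hα1.ne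
  have hL1 : 1 - α < L := by linarith
  have hL0 : 0 < L := by linarith
  have hpow : ∀ x : ℝ, α ^ x = Real.exp (-(L * x)) := by
    intro x
    rw [Real.rpow_def_of_pos hα0, hL]; congr 1; ring
  have hexpL : α * Real.exp L = 1 := by
    rw [hL, Real.exp_neg, Real.exp_log hα0]; exact mul_inv_cancel₀ hα0.ne'
  let q : ℝ → ℝ := fun x => L * (1 - c + c * x) + c - c * Real.exp (L * x)
  have hqd : ∀ x, HasDerivAt q (c * L * (1 - Real.exp (L * x))) x := by
    intro x
    have h1 : HasDerivAt (fun x : ℝ => L * x) L x := by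
      simpa using (hasDerivAt_id x).const_mul L
    have h2 : HasDerivAt (fun x : ℝ => L * (1 - c + c * x) + c) (L * c) x := by
      have := ((((hasDerivAt_id x).const_mul c).const_add (1 - c)).const_mul L).add_const c
      simpa using this
    refine (h2.sub (h1.exp.const_mul c)).congr_deriv ?_
    ring
  have hqc : Continuous q := continuous_iff_continuousAt.2 fun x => (hqd x).continuousAt
  have hqa : StrictAntiOn q (Set.Ici 1) := by
    apply strictAntiOn_of_deriv_neg (convex_Ici 1) hqc.continuousOn
    intro x hx
    rw [interior_Ici, Set.mem_Ioi] at hx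
    rw [(hqd x).deriv]
    have : 1 < Real.exp (L * x) := Real.one_lt_exp_iff.2 (by positivity)
    have h3 : 0 < c * L := by positivity
    nlinarith
  have hq1 : 0 < q 1 := by
    have h : 0 < α * q 1 := by
      have : α * q 1 = α * L - c * (1 - α) := by
        simp only [q, mul_one]
        linear_combination (-c) * hexpL
      rw [this]
      nlinarith
    exact pos_of_mul_pos_right h hα0.le
  obtain ⟨M, hM⟩ : ∃ M, M = 1 + 2 / (c * L) := ⟨_, rfl⟩
  have hM1 : 1 ≤ M := by
    rw [hM]; have : 0 < 2 / (c * L) := by positivity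
    linarith
  have hqM : q M < 0 := by
    have h1 := Real.quadratic_le_exp_of_nonneg (x := L * M) (by positivity)
    have h2 : c * L * M = c * L + 2 := by rw [hM]; field_simp
    have h3 : c * (1 + L * M + (L * M) ^ 2 / 2) ≤ c * Real.exp (L * M) :=
      mul_le_mul_of_nonneg_left h1 hc0.le
    have h4 : c * (L * M) ^ 2 / 2 = (c * L + 2) * (L * M) / 2 := by rw [← h2]; ring
    have h5 : L ≤ L * M := by nlinarith
    have h6 : 0 < c * L := by positivity
    simp only [q]
    nlinarith [mul_pos h6 (lt_of_lt_of_le hL0 h5)]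
  obtain ⟨z, hz, hqz⟩ : ∃ z ∈ Set.Icc 1 M, q z = 0 :=
    intermediate_value_Icc' hM1 hqc.continuousOn ⟨hqM.le, hq1.le⟩
  have hden : ∀ x : ℝ, 1 ≤ x → 0 < 1 - c + c * x := by intro x hx; nlinarith
  have hgd : ∀ x : ℝ, 1 ≤ x → HasDerivAt g
      (q x * (Real.exp (-(L * x)) * (1 - α) / ((1 - α) * (1 - c + c * x)) ^ 2)) x := by
    intro x hx
    have hgf : g = fun x => (1 - Real.exp (-(L * x))) / ((1 - α) * (1 - c + c * x)) := by
      funext y; rw [hg, hpow]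
    rw [hgf]
    have h1 : HasDerivAt (fun x : ℝ => -(L * x)) (-L) x := by
      have h0 : HasDerivAt (fun x : ℝ => L * x) L x := by
        simpa using (hasDerivAt_id x).const_mul L
      exact h0.neg
    have h2 : HasDerivAt (fun x : ℝ => (1 - α) * (1 - c + c * x)) ((1 - α) * c) x := by
      simpa using (((hasDerivAt_id x).const_mul c).const_add (1 - c)).const_mul (1 - α)
    have hne : (1 - α) * (1 - c + c * x) ≠ 0 :=
      (mul_pos (by linarith) (hden x hx)).ne'
    refine ((h1.exp.const_sub 1).div h2 hne).congr_deriv (Eq.symm ?_)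
    rw [← mul_div_assoc]
    congr 1
    have he : Real.exp (L * x) * Real.exp (-(L * x)) = 1 := by
      rw [← Real.exp_add]; simp
    simp only [q]
    linear_combination (-(c * (1 - α))) * he
  have hfac : ∀ x : ℝ, 1 ≤ x →
      0 < Real.exp (-(L * x)) * (1 - α) / ((1 - α) * (1 - c + c * x)) ^ 2 := by
    intro x hx
    have := hden x hx
    have : 0 < 1 - α := by linarith
    positivity
  have hmz : StrictMonoOn g (Set.Icc 1 z) := by
    apply strictMonoOn_of_deriv_pos (convex_Icc 1 z)
    · intro x hx
      exact (hgd x hx.1).continuousAt.continuousWithinAt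
    · intro x hx
      rw [interior_Icc] at hx
      rw [(hgd x hx.1.le).deriv]
      refine mul_pos ?_ (hfac x hx.1.le)
      rw [← hqz]
      exact hqa hx.1.le hz.1 hx.2
  have haz : StrictAntiOn g (Set.Ici z) := by
    apply strictAntiOn_of_deriv_neg (convex_Ici z)
    · intro x hx
      exact (hgd x (hz.1.trans hx)).continuousAt.continuousWithinAt
    · intro x hx
      rw [interior_Ici, Set.mem_Ioi] at hx
      have hx1 : 1 ≤ x := hz.1.trans hx.le
      rw [(hgd x hx1).deriv]
      refine mul_neg_of_neg_of_pos ?_ (hfac x hx1)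
      rw [← hqz]
      exact hqa hz.1 hx1 hx
  refine ⟨z, ⟨hz.1, hmz, haz⟩, ?_⟩
  · have key : ∀ a b : ℝ, 1 ≤ a → a < b → StrictAntiOn g (Set.Ici a) →
        StrictMonoOn g (Set.Icc 1 b) → False := by
      intro a b h1 hab ha hm
      have h2 := ha (Set.mem_Ici.2 le_rfl) (Set.mem_Ici.2 hab.le) hab
      have h3 := hm ⟨h1, hab.le⟩ ⟨h1.trans hab.le, le_rfl⟩ hab
      exact lt_asymm h2 h3
    rintro y ⟨hy1, hym, hya⟩
    rcases lt_trichotomy y z with h | h | h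
    · exact (key y z hy1 h hya hmz).elim
    · exact h
    · exact (key z y hz.1 h haz hym).elim
end

section
/- Let 0 < c < α < 1 and define F : ℝ → ℝ by F(γ) = α^γ·(−log α)·(1 − c + c·γ) − c·(1 − α^γ). Then F is strictly decreasing on [1, ∞), F(1) = α·(−log α) − c·(1−α) > 0, and F(γ) tends to −c as γ → ∞; consequently F has a unique zero γ̂ in (1, ∞), with F(γ) > 0 for 1 ≤ γ < γ̂ and F(γ) < 0 for γ > γ̂. -/
/-- The sign-determining factor F of the derivative of the speculative decoding
speedup: strictly decreasing, positive at 1, tends to -c, with a unique zero. -/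
theorem stmt_6 (α c : ℝ) (hc0 : 0 < c) (hcα : c < α) (hα1 : α < 1)
    (F : ℝ → ℝ)
    (hF : ∀ γ : ℝ, F γ = α ^ γ * (-Real.log α) * (1 - c + c * γ) - c * (1 - α ^ γ)) :
    StrictAntiOn F (Set.Ici 1) ∧
    F 1 = α * (-Real.log α) - c * (1 - α) ∧ 0 < F 1 ∧
    Filter.Tendsto F Filter.atTop (nhds (-c)) ∧
    (∃! γ₀ : ℝ, 1 < γ₀ ∧ F γ₀ = 0) ∧
    (∀ γ₀ : ℝ, 1 < γ₀ → F γ₀ = 0 →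
      (∀ γ : ℝ, 1 ≤ γ → γ < γ₀ → 0 < F γ) ∧ (∀ γ : ℝ, γ₀ < γ → F γ < 0)) := by
  have hα0 : 0 < α := hc0.trans hcα
  have hlog : Real.log α < α - 1 := Real.log_lt_sub_one_of_pos hα0 hα1.ne
  obtain ⟨L, hL⟩ : ∃ L, L = -Real.log α := ⟨_, rfl⟩
  have hLpos : 0 < L := by linarith
  have hF1 : F 1 = α * (-Real.log α) - c * (1 - α) := by
    rw [hF, Real.rpow_one]; ring
  have hF1pos : 0 < F 1 := by
    rw [hF1, ← hL]
    nlinarith [mul_pos (sub_pos.2 hcα) (sub_pos.2 hα1),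
      mul_pos hα0 (show 0 < L - (1 - α) by linarith)]
  have hFe : F = fun γ => Real.exp (-(L * γ)) * L * (1 - c + c * γ)
      - c * (1 - Real.exp (-(L * γ))) := by
    funext γ
    rw [hF, Real.rpow_def_of_pos hα0, ← hL]
    have : Real.log α * γ = -(L * γ) := by rw [hL]; ring
    rw [this]
  have hder : ∀ γ, HasDerivAt F (-(Real.exp (-(L * γ)) * L ^ 2 * (1 - c + c * γ))) γ := by
    intro γ
    rw [hFe]
    have h1 : HasDerivAt (fun γ : ℝ => Real.exp (-(L * γ)))
        (Real.exp (-(L * γ)) * (-(L * 1))) γ :=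
      (((hasDerivAt_id γ).const_mul L).neg).exp
    have h2 : HasDerivAt (fun γ : ℝ => 1 - c + c * γ) (c * 1) γ :=
      ((hasDerivAt_id γ).const_mul c).const_add (1 - c)
    have h3 := ((h1.mul_const L).mul h2).sub ((h1.const_sub 1).const_mul c)
    refine h3.congr_deriv ?_
    ring
  have hcont : Continuous F :=
    continuous_iff_continuousAt.2 fun γ => (hder γ).continuousAt
  have hanti : StrictAntiOn F (Set.Ici 1) := by
    apply strictAntiOn_of_deriv_neg (convex_Ici 1) hcont.continuousOn
    intro x hx
    rw [interior_Ici] at hx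
    have hx1 : (1 : ℝ) < x := hx
    rw [(hder x).deriv]
    have : 0 < 1 - c + c * x := by nlinarith
    have := Real.exp_pos (-(L * x))
    rw [neg_lt_zero]
    positivity
  have hlim : Filter.Tendsto F Filter.atTop (nhds (-c)) := by
    have hLx : Filter.Tendsto (fun x : ℝ => L * x) Filter.atTop Filter.atTop :=
      Filter.tendsto_id.const_mul_atTop hLpos
    have h0 := (Real.tendsto_pow_mul_exp_neg_atTop_nhds_zero 0).comp hLx
    have h1 := (Real.tendsto_pow_mul_exp_neg_atTop_nhds_zero 1).comp hLx
    have h2 := ((h0.mul_const (L * (1 - c) + c)).add (h1.mul_const c)).sub_const c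
    rw [hFe]
    convert h2 using 1
    · funext x
      simp only [Function.comp]
      ring
    · simp
  refine ⟨hanti, hF1, hF1pos, hlim, ?_, ?_⟩
  · obtain ⟨N, hN, hN1⟩ := ((hlim.eventually_lt_const (show -c < 0 by linarith)).and
      (Filter.eventually_ge_atTop 1)).exists
    obtain ⟨z, hz, hz0⟩ := intermediate_value_Icc' hN1 hcont.continuousOn
      (show (0 : ℝ) ∈ Set.Icc (F N) (F 1) from ⟨hN.le, hF1pos.le⟩)
    refine ⟨z, ⟨lt_of_le_of_ne hz.1 ?_, hz0⟩, ?_⟩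
    · rintro rfl
      linarith
    · rintro y ⟨hy, hy0⟩
      exact hanti.injOn (Set.mem_Ici.2 hy.le) (Set.mem_Ici.2 hz.1) (hy0.trans hz0.symm)
  · intro z hz hz0
    refine ⟨fun y hy hyz => ?_, fun y hy => ?_⟩
    · rw [← hz0]
      exact hanti (Set.mem_Ici.2 hy) (Set.mem_Ici.2 hz.le) hyz
    · rw [← hz0]
      exact hanti (Set.mem_Ici.2 hz.le) (Set.mem_Ici.2 (hz.trans hy).le) hy
end

section
/- Let 0 < α < 1 and 0 < c < 1, and define f : ℝ → ℝ by f(γ) = (1 − α^γ) / (1 − α + c·α·(1 − α^γ) − c·γ·α^γ·(1 − α)). Then f is strictly increasing on the real interval [1, 1/c]. -/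
/-- The asynchronous Lookahead Reasoning depth-limited speedup is strictly
increasing on [1, 1/c]. -/
theorem stmt_7 (α c : ℝ) (hα0 : 0 < α) (hα1 : α < 1) (hc0 : 0 < c) (hc1 : c < 1)
    (f : ℝ → ℝ)
    (hf : ∀ γ : ℝ, f γ =
      (1 - α ^ γ) / (1 - α + c * α * (1 - α ^ γ) - c * γ * α ^ γ * (1 - α))) :
    StrictMonoOn f (Set.Icc 1 (1 / c)) := by
  have hD : ∀ γ ∈ Set.Icc 1 (1 / c), α ^ γ < 1 ∧ 0 < α ^ γ ∧ 0 ≤ 1 - c * γ ∧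
      0 < 1 - α + c * α * (1 - α ^ γ) - c * γ * α ^ γ * (1 - α) := by
    rintro γ ⟨h1, h2⟩
    have hx1 : α ^ γ < 1 := Real.rpow_lt_one hα0.le hα1 (by linarith)
    have hx0 : 0 < α ^ γ := Real.rpow_pos_of_pos hα0 γ
    have hg : 0 ≤ 1 - c * γ := by
      rw [le_div_iff₀ hc0] at h2
      linarith
    refine ⟨hx1, hx0, hg, ?_⟩
    generalize α ^ γ = x at *
    have e1 : 0 < (1 - α) * (1 - x) := mul_pos (by linarith) (by linarith)
    have e2 : 0 ≤ (1 - α) * (x * (1 - c * γ)) :=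
      mul_nonneg (by linarith) (mul_nonneg hx0.le hg)
    have e3 : 0 < c * α * (1 - x) := mul_pos (mul_pos hc0 hα0) (by linarith)
    nlinarith
  intro a ha b hb hab
  obtain ⟨ha1, ha0, hga, hDa⟩ := hD a ha
  obtain ⟨hb1, hb0, hgb, hDb⟩ := hD b hb
  have hlt : α ^ b < α ^ a := Real.rpow_lt_rpow_of_exponent_gt hα0 hα1 hab
  rw [hf a, hf b, div_lt_div_iff₀ hDa hDb]
  generalize α ^ a = x at *
  generalize α ^ b = y at *
  have hcab : 1 - c * b < 1 - c * a := by nlinarith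
  have k1 : (1 - x) * y < (1 - y) * x := by nlinarith
  have k2 : (1 - x) * y * (1 - c * b) ≤ (1 - y) * x * (1 - c * b) :=
    mul_le_mul_of_nonneg_right k1.le hgb
  have k3 : (1 - y) * x * (1 - c * b) < (1 - y) * x * (1 - c * a) :=
    mul_lt_mul_of_pos_left hcab (mul_pos (by linarith) ha0)
  have k4 := mul_lt_mul_of_pos_left (k2.trans_lt k3) (sub_pos.2 hα1)
  linarith
end

section
/- Let 0 < α < 1 be fixed. Then the function x ↦ (−log α)·x·α^x/(1 − α^x) is strictly decreasing on [1, ∞). -/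
/-- The elasticity factor a(α, x) is strictly decreasing in x on [1, ∞). -/
theorem stmt_9 (α : ℝ) (hα0 : 0 < α) (hα1 : α < 1) :
    StrictAntiOn (fun x : ℝ => (-Real.log α) * x * α ^ x / (1 - α ^ x))
      (Set.Ici 1) := by
  have hL : 0 < -Real.log α := by
    have := Real.log_neg hα0 hα1
    linarith
  have key : ∀ x : ℝ, 0 < x → (-Real.log α) * x * α ^ x / (1 - α ^ x)
      = ((Real.exp (-Real.log α * x) - 1) / (-Real.log α * x))⁻¹ := by
    intro x hx
    have ht : 0 < -Real.log α * x := mul_pos hL hx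
    have h1 : α ^ x = (Real.exp (-Real.log α * x))⁻¹ := by
      rw [Real.rpow_def_of_pos hα0, ← Real.exp_neg]
      congr 1
      ring
    rw [h1]
    generalize -Real.log α * x = t at *
    have h2 : 1 < Real.exp t := Real.one_lt_exp_iff.mpr ht
    have h3 : Real.exp t - 1 ≠ 0 := by linarith
    have h4 : Real.exp t ≠ 0 := by positivity
    have h5 : 1 - (Real.exp t)⁻¹ = (Real.exp t - 1) / Real.exp t := by
      field_simp
    rw [h5, inv_div]
    field_simp
  intro x hx y hy hxy
  have hx0 : 0 < x := lt_of_lt_of_le one_pos hx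
  have hy0 : 0 < y := hx0.trans hxy
  have hs := mul_pos hL hx0
  have ht := mul_pos hL hy0
  have hst := mul_lt_mul_of_pos_left hxy hL
  show _ / _ < _ / _
  rw [key x hx0, key y hy0]
  have h := strictConvexOn_exp.secant_strict_mono (Set.mem_univ 0) (Set.mem_univ _)
    (Set.mem_univ _) hs.ne' ht.ne' hst
  simp only [Real.exp_zero, sub_zero] at h
  refine inv_strictAnti₀ ?_ h
  have := Real.one_lt_exp_iff.mpr hs
  exact div_pos (by linarith) hs
end

section
/- Let x ≥ 1 be fixed. Then the function α ↦ (−log α)·x·α^x/(1 − α^x) is strictly increasing on the interval (0.5, 0.8). -/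
/-- The elasticity factor a(α, x) is strictly increasing in α on (0.5, 0.8). -/
theorem stmt_10 (x : ℝ) (hx : 1 ≤ x) :
    StrictMonoOn (fun α : ℝ => (-Real.log α) * x * α ^ x / (1 - α ^ x))
      (Set.Ioo 0.5 0.8) := by
  have key : ∀ c ∈ Set.Ioo (0.5:ℝ) 0.8, 0 < -Real.log c * x ∧
      (-Real.log c) * x * c ^ x / (1 - c ^ x)
        = ((Real.exp (-Real.log c * x) - 1) / (-Real.log c * x))⁻¹ := by
    intro c hc
    have h0 : 0 < c := lt_trans (by norm_num) hc.1
    have h1 : c < 1 := lt_trans hc.2 (by norm_num)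
    have hl : Real.log c < 0 := Real.log_neg h0 h1
    have hp : 0 < c ^ x := Real.rpow_pos_of_pos h0 x
    have hq : c ^ x < 1 := Real.rpow_lt_one h0.le h1 (by linarith)
    have he : Real.exp (-Real.log c * x) = (c ^ x)⁻¹ := by
      rw [Real.rpow_def_of_pos h0, ← Real.exp_neg, neg_mul]
    refine ⟨mul_pos (by linarith) (by linarith), ?_⟩
    rw [he, inv_div]
    have h3 : (1 - c ^ x) ≠ 0 := by linarith
    have h4 : (c ^ x)⁻¹ - 1 = (1 - c ^ x) / c ^ x := by
      rw [sub_div, div_self hp.ne', one_div]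
    rw [h4, div_div_eq_mul_div]
  intro a ha b hb hab
  obtain ⟨ta, ea⟩ := key a ha
  obtain ⟨tb, eb⟩ := key b hb
  have h0 : 0 < a := lt_trans (by norm_num) ha.1
  have hl := Real.log_lt_log h0 hab
  have hlt : -Real.log b * x < -Real.log a * x :=
    mul_lt_mul_of_pos_right (by linarith) (by linarith)
  have hs := strictConvexOn_exp.secant_strict_mono (Set.mem_univ 0) (Set.mem_univ _)
    (Set.mem_univ _) tb.ne' ta.ne' hlt
  simp only [Real.exp_zero, sub_zero] at hs
  show _ / _ < _ / _
  rw [ea, eb]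
  refine inv_strictAnti₀ (div_pos ?_ tb) hs
  have := Real.one_lt_exp_iff.2 tb
  linarith
end

section
/- For every real x ≥ 10 and every α ∈ (0.5, 0.8), one has (−log α)·x·α^x/(1 − α^x) < 0.27. -/
/-- Numerical bound on the elasticity factor: a(α, x) < 0.27 for x ≥ 10 and
α ∈ (0.5, 0.8). -/
theorem stmt_11 :
    ∀ x α : ℝ, 10 ≤ x → α ∈ Set.Ioo (0.5 : ℝ) 0.8 →
      (-Real.log α) * x * α ^ x / (1 - α ^ x) < 0.27 := by
  rintro x α hx ⟨h1, h2⟩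
  have hα : 0 < α := by norm_num at h1; linarith
  have hL : Real.log (5/4) < 0.2244 := by
    rw [Real.log_lt_iff_lt_exp (by norm_num)]
    have h := Real.quadratic_le_exp_of_nonneg (x := 0.1122) (by norm_num)
    have e : Real.exp 0.2244 = Real.exp 0.1122 * Real.exp 0.1122 := by
      rw [← Real.exp_add]; norm_num
    rw [e]
    norm_num at h ⊢
    nlinarith
  have hL0 : 0 < Real.log (5/4) := Real.log_pos (by norm_num)
  have hlog : Real.log (5/4) ≤ -Real.log α := by
    rw [← Real.log_inv]
    apply Real.log_le_log (by norm_num)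
    rw [le_inv_comm₀ (by norm_num) hα]
    norm_num at h2 ⊢
    linarith
  set L := Real.log (5/4) with hLd
  obtain ⟨t, ht⟩ : ∃ t, t = -Real.log α * x := ⟨_, rfl⟩
  have htL : 10 * L ≤ t := by rw [ht]; nlinarith
  have hpow : α ^ x = Real.exp (-t) := by
    rw [Real.rpow_def_of_pos hα, ht]; congr 1; ring
  have he0 : Real.exp (10 * L) = (5/4)^10 := by
    rw [show (10:ℝ) * L = ((10:ℕ):ℝ) * L by norm_num, Real.exp_nat_mul, hLd,
      Real.exp_log (by norm_num)]
  have he : (5/4)^10 * (1 + (t - 10 * L)) ≤ Real.exp t := by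
    have : Real.exp t = Real.exp (10*L) * Real.exp (t - 10 * L) := by
      rw [← Real.exp_add]; congr 1; ring
    rw [this, he0]
    have := Real.add_one_le_exp (t - 10 * L)
    gcongr
    linarith
  have hkey : t < 0.27 * (Real.exp t - 1) := by
    norm_num at he hL ⊢
    linarith
  have hprod : Real.exp t * Real.exp (-t) = 1 := by
    rw [← Real.exp_add]; simp
  have hp : 0 < Real.exp (-t) := Real.exp_pos _
  have hlt : Real.exp (-t) < 1 := by
    rw [Real.exp_lt_one_iff]; linarith
  rw [hpow, ← ht, div_lt_iff₀ (by linarith)]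
  have := mul_lt_mul_of_pos_right hkey hp
  have e2 : 0.27 * (Real.exp t - 1) * Real.exp (-t) = 0.27 * (1 - Real.exp (-t)) := by
    linear_combination 0.27 * hprod
  linarith
end

section
/- For every y ∈ (0, 1), one has 2 − y + (y − 2 + 1/y)·log(1 − y) < 1.157. -/
/-- auxiliary constant, just below 1.157, chosen so that the critical points are rational -/
noncomputable def auxK : ℝ := 905822 / 783000

/-- auxiliary function -/
noncomputable def auxG (x : ℝ) : ℝ := Real.log x - ((auxK - 1) / x ^ 2 - auxK / x + 1)

lemma auxG_deriv {x : ℝ} (hx : 0 < x) :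
    HasDerivAt auxG ((x - 0.434) * (x - (auxK - 0.434)) / x ^ 3) x := by
  have h1 := Real.hasDerivAt_log hx.ne'
  have h2 := (hasDerivAt_const x (auxK - 1)).div (hasDerivAt_pow 2 x) (pow_ne_zero 2 hx.ne')
  have h3 := (hasDerivAt_const x auxK).div (hasDerivAt_id x) hx.ne'
  have h : HasDerivAt auxG _ x := h1.sub ((h2.sub h3).add_const 1)
  convert h using 1
  simp only [id, auxK]
  field_simp
  ring

lemma auxG_cont {s : Set ℝ} (hs : ∀ x ∈ s, 0 < x) : ContinuousOn auxG s :=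
  fun x hx => (auxG_deriv (hs x hx)).continuousAt.continuousWithinAt

lemma auxG_mono {a b : ℝ} (ha : 0 < a) (hab : a ≤ b)
    (h : ∀ x, a < x → x < b → 0 ≤ (x - 0.434) * (x - (auxK - 0.434))) : auxG a ≤ auxG b := by
  have hm : MonotoneOn auxG (Set.Icc a b) := by
    apply monotoneOn_of_deriv_nonneg (convex_Icc a b)
      (auxG_cont fun x hx => lt_of_lt_of_le ha hx.1)
    · intro x hx
      rw [interior_Icc] at hx
      exact (auxG_deriv (ha.trans hx.1)).differentiableAt.differentiableWithinAt
    · intro x hx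
      rw [interior_Icc] at hx
      have hx0 := ha.trans hx.1
      rw [(auxG_deriv hx0).deriv]
      exact div_nonneg (h x hx.1 hx.2) (by positivity)
  exact hm ⟨le_rfl, hab⟩ ⟨hab, le_rfl⟩ hab

lemma auxG_anti {a b : ℝ} (ha : 0 < a) (hab : a ≤ b)
    (h : ∀ x, a < x → x < b → (x - 0.434) * (x - (auxK - 0.434)) ≤ 0) : auxG b ≤ auxG a := by
  have hm : AntitoneOn auxG (Set.Icc a b) := by
    apply antitoneOn_of_deriv_nonpos (convex_Icc a b)
      (auxG_cont fun x hx => lt_of_lt_of_le ha hx.1)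
    · intro x hx
      rw [interior_Icc] at hx
      exact (auxG_deriv (ha.trans hx.1)).differentiableAt.differentiableWithinAt
    · intro x hx
      rw [interior_Icc] at hx
      have hx0 := ha.trans hx.1
      rw [(auxG_deriv hx0).deriv]
      exact div_nonpos_of_nonpos_of_nonneg (h x hx.1 hx.2) (by positivity)
  exact hm ⟨le_rfl, hab⟩ ⟨hab, le_rfl⟩ hab

lemma auxG_crit : auxG 0.434 ≤ 0 := by
  have h := Real.abs_log_sub_add_sum_range_le (x := 0.132) (by rw [abs_of_pos] <;> norm_num) 4
  rw [abs_of_pos (by norm_num : (0:ℝ) < 0.132)] at h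
  have h' := (abs_le.1 h).2
  norm_num [Finset.sum_range_succ] at h'
  have e : Real.log (0.434 : ℝ) = Real.log (217 / 250) - Real.log 2 := by
    rw [← Real.log_div (by norm_num) (by norm_num)]
    norm_num
  have l2 := Real.log_two_gt_d9
  unfold auxG auxK
  rw [e]
  norm_num at h' l2 ⊢
  linarith

lemma auxG_nonpos {x : ℝ} (hx : 0 < x) (hx1 : x < 1) : auxG x ≤ 0 := by
  have hK1 : (0.868 : ℝ) < auxK := by norm_num [auxK]
  rcases le_total x 0.434 with h | h
  · refine (auxG_mono hx h fun z _ h2 => ?_).trans auxG_crit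
    exact mul_nonneg_of_nonpos_of_nonpos (by linarith) (by linarith)
  rcases le_total x (auxK - 0.434) with h' | h'
  · refine (auxG_anti (by norm_num) h fun z h1 h2 => ?_).trans auxG_crit
    exact mul_nonpos_of_nonneg_of_nonpos (by linarith) (by linarith)
  · have h1 : auxG 1 = 0 := by simp [auxG]
    rw [← h1]
    refine auxG_mono hx hx1.le fun z h1 h2 => ?_
    exact mul_nonneg (by linarith) (by linarith)

/-- Bound on F(y) = 2 − y + (y − 2 + 1/y)·log(1 − y) on (0, 1). -/
theorem stmt_13 :
    ∀ y : ℝ, y ∈ Set.Ioo (0 : ℝ) 1 →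
      2 - y + (y - 2 + 1 / y) * Real.log (1 - y) < 1.157 := by
  rintro y ⟨h0, h1⟩
  have hx : 0 < 1 - y := by linarith
  have h := auxG_nonpos hx (by linarith)
  unfold auxG at h
  have hc : y - 2 + 1 / y = (1 - y) ^ 2 / y := by
    field_simp
    ring
  have hm := mul_le_mul_of_nonneg_left (sub_nonpos.1 h)
    (by positivity : 0 ≤ (1 - y) ^ 2 / y)
  have he : (1 - y) ^ 2 / y * ((auxK - 1) / (1 - y) ^ 2 - auxK / (1 - y) + 1)
      = auxK - 2 + y := by
    have := hx.ne'
    field_simp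
    ring
  have hK : auxK < 1.157 := by norm_num [auxK]
  rw [hc]
  linarith
end

section
/- Let 0 < α < 1 and 0 < c < 1, and define D : ℝ → ℝ by D(M) = (1 + α^{M/2})·(1 − c + c·M/2)/(1 − c + c·M). Then D is strictly decreasing on [2, ∞) and D(2) = (1 + α)/(1 + c). -/
/-- The threshold quantity D(M) is strictly decreasing on [2, ∞) and
D(2) = (1 + α)/(1 + c). -/
theorem stmt_15 (α c : ℝ) (hα0 : 0 < α) (hα1 : α < 1) (hc0 : 0 < c) (hc1 : c < 1)
    (D : ℝ → ℝ)
    (hD : ∀ M : ℝ, D M = (1 + α ^ (M / 2)) * (1 - c + c * M / 2) / (1 - c + c * M)) :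
    StrictAntiOn D (Set.Ici 2) ∧ D 2 = (1 + α) / (1 + c) := by
  constructor
  · intro x hx y hy hxy
    simp only [Set.mem_Ici] at hx hy
    rw [hD, hD, mul_div_assoc (1 + α ^ (y / 2)), mul_div_assoc (1 + α ^ (x / 2))]
    have hp : α ^ (y / 2) < α ^ (x / 2) :=
      Real.rpow_lt_rpow_of_exponent_gt hα0 hα1 (by linarith)
    have hpx : 0 < α ^ (x / 2) := Real.rpow_pos_of_pos hα0 _
    have hcx : 0 < c * x := mul_pos hc0 (by linarith)
    have hcy : 0 < c * y := mul_pos hc0 (by linarith)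
    have hcxy : c * x < c * y := mul_lt_mul_of_pos_left hxy hc0
    have hq : (1 - c + c * y / 2) / (1 - c + c * y) ≤ (1 - c + c * x / 2) / (1 - c + c * x) := by
      rw [div_le_div_iff₀ (by linarith) (by linarith)]
      nlinarith [mul_pos (sub_pos.2 hc1) (sub_pos.2 hcxy)]
    have hqy : 0 < (1 - c + c * y / 2) / (1 - c + c * y) :=
      div_pos (by linarith) (by linarith)
    exact mul_lt_mul (by linarith) hq hqy (by linarith)
  · rw [hD]
    norm_num
    ring
end

section
/- Let α₁, α₂ ∈ (0,1), c₁, c₂ ∈ (0,1), and let M ≥ 4 be an even natural number. Then at least one of the following inequalities holds: (1 + α₁)/(1 + c₁) ≥ (1 + α₂^{M/2})·(1 − c₂ + c₂·M/2)/(1 − c₂ + c₂·M), or (1 + α₂)/(1 + c₂) ≥ (1 + α₁^{M/2})·(1 − c₁ + c₁·M/2)/(1 − c₁ + c₁·M). -/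
theorem key_bound (a c : ℝ) (ha : a ∈ Set.Ioo (0 : ℝ) 1) (hc : c ∈ Set.Ioo (0 : ℝ) 1)
    (M : ℕ) (hM : 4 ≤ M) :
    (1 + a ^ ((M : ℝ) / 2)) * (1 - c + c * (M : ℝ) / 2) / (1 - c + c * (M : ℝ))
      ≤ (1 + a) / (1 + c) := by
  obtain ⟨ha0, ha1⟩ := ha
  obtain ⟨hc0, hc1⟩ := hc
  have hM' : (4 : ℝ) ≤ M := by exact_mod_cast hM
  have hp : a ^ ((M : ℝ) / 2) ≤ a := by
    have := Real.rpow_le_rpow_of_exponent_ge ha0 ha1.le (show (1 : ℝ) ≤ (M : ℝ) / 2 by linarith)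
    rwa [Real.rpow_one] at this
  have hcM : 0 < c * (M : ℝ) := by positivity
  have hg : (1 - c + c * (M : ℝ) / 2) * (1 + c) ≤ 1 - c + c * (M : ℝ) := by
    have : 0 ≤ c * (1 - c) * ((M : ℝ) / 2 - 1) :=
      mul_nonneg (mul_nonneg hc0.le (by linarith)) (by linarith)
    nlinarith
  rw [div_le_div_iff₀ (by linarith) (by linarith), mul_assoc]
  exact mul_le_mul (by linarith) hg (mul_nonneg (by linarith) (by linarith)) (by linarith)

/-- At least one of the two threshold inequalities in the hybrid-optimality
theorem for synchronous Lookahead Reasoning must hold. -/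
theorem stmt_16 (α₁ α₂ c₁ c₂ : ℝ)
    (hα₁ : α₁ ∈ Set.Ioo (0 : ℝ) 1) (hα₂ : α₂ ∈ Set.Ioo (0 : ℝ) 1)
    (hc₁ : c₁ ∈ Set.Ioo (0 : ℝ) 1) (hc₂ : c₂ ∈ Set.Ioo (0 : ℝ) 1)
    (M : ℕ) (hM : 4 ≤ M) (hMe : Even M) :
    (1 + α₁) / (1 + c₁) ≥
        (1 + α₂ ^ ((M : ℝ) / 2)) * (1 - c₂ + c₂ * (M : ℝ) / 2) /
          (1 - c₂ + c₂ * (M : ℝ)) ∨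
    (1 + α₂) / (1 + c₂) ≥
        (1 + α₁ ^ ((M : ℝ) / 2)) * (1 - c₁ + c₁ * (M : ℝ) / 2) /
          (1 - c₁ + c₁ * (M : ℝ)) := by
  have h1 := key_bound α₁ c₁ hα₁ hc₁ M hM
  have h2 := key_bound α₂ c₂ hα₂ hc₂ M hM
  rcases le_total ((1 + α₁) / (1 + c₁)) ((1 + α₂) / (1 + c₂)) with h | h
  · exact Or.inr (h1.trans h)
  · exact Or.inl (h2.trans h)
end

section
/- Let 0.52 < α₁ < 0.8, 0.52 < α₂ < 0.8, 0 < c₁ < 1/3, 0 < c₂ < 1/5, and let M ≥ 16 be an even natural number. Define f(γ) = (1 − α₁^γ)/(1 − α₁ + c₁·α₁·(1 − α₁^γ) − c₁·γ·α₁^γ·(1 − α₁)) and g(γ) = (1 − α₂^γ)/((1 − α₂)·(1 − c₂ + c₂·γ)), and w(γ) = f(γ)·g(M/γ). Then w(2) > w(1). -/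
/-- Hybrid splitting (2, M/2) beats token-level-only (1, M): w(2) > w(1). -/
theorem stmt_17 (α₁ α₂ c₁ c₂ : ℝ)
    (hα₁l : 0.52 < α₁) (hα₁u : α₁ < 0.8) (hα₂l : 0.52 < α₂) (hα₂u : α₂ < 0.8)
    (hc₁l : 0 < c₁) (hc₁u : c₁ < 1 / 3) (hc₂l : 0 < c₂) (hc₂u : c₂ < 1 / 5)
    (M : ℕ) (hM : 16 ≤ M) (hMe : Even M)
    (f g w : ℝ → ℝ)
    (hf : ∀ γ : ℝ, f γ =
      (1 - α₁ ^ γ) / (1 - α₁ + c₁ * α₁ * (1 - α₁ ^ γ) - c₁ * γ * α₁ ^ γ * (1 - α₁)))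
    (hg : ∀ γ : ℝ, g γ = (1 - α₂ ^ γ) / ((1 - α₂) * (1 - c₂ + c₂ * γ)))
    (hw : ∀ γ : ℝ, w γ = f γ * g ((M : ℝ) / γ)) :
    w 2 > w 1 := by
  norm_num at hα₁l hα₁u hα₂l hα₂u
  obtain ⟨m, rfl⟩ := hMe
  have hm : 8 ≤ m := by omega
  have hmr : (8 : ℝ) ≤ m := by exact_mod_cast hm
  have h1 : f 1 = 1 := by
    rw [hf, Real.rpow_one]
    have : 1 - α₁ + c₁ * α₁ * (1 - α₁) - c₁ * 1 * α₁ * (1 - α₁) = 1 - α₁ := by ring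
    rw [this]
    exact div_self (by linarith)
  have h2 : 6 / 5 < f 2 := by
    rw [hf, Real.rpow_two]
    have e : 1 - α₁ + c₁ * α₁ * (1 - α₁ ^ 2) - c₁ * 2 * α₁ ^ 2 * (1 - α₁)
        = (1 - α₁) * (1 + c₁ * (α₁ * (1 - α₁))) := by ring
    have e2 : 1 - α₁ ^ 2 = (1 - α₁) * (1 + α₁) := by ring
    rw [e, e2, mul_div_mul_left _ _ (by linarith)]
    have p : 0 < α₁ * (1 - α₁) := mul_pos (by linarith) (by linarith)
    have q : 0 < c₁ * (α₁ * (1 - α₁)) := mul_pos hc₁l p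
    have q2 : c₁ * (α₁ * (1 - α₁)) ≤ 1 / 3 * (α₁ * (1 - α₁)) :=
      mul_le_mul_of_nonneg_right hc₁u.le p.le
    rw [lt_div_iff₀ (by linarith)]
    nlinarith [sq_nonneg (α₁ - 1 / 2)]
  have hx0 : 0 < α₂ ^ m := pow_pos (by linarith) m
  have hx1 : α₂ ^ m ≤ 1 / 5 := by
    calc α₂ ^ m ≤ α₂ ^ 8 := pow_le_pow_of_le_one (by linarith) (by linarith) hm
      _ ≤ (4 / 5) ^ 8 := pow_le_pow_left₀ (by linarith) (by linarith) 8
      _ ≤ 1 / 5 := by norm_num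
  have em : ((m + m : ℕ) : ℝ) / 2 = (m : ℝ) := by push_cast; ring
  have hD : 0 < 1 - c₂ + c₂ * m := by
    have : 0 < c₂ * m := by positivity
    linarith
  have hb : 0 < 1 - α₂ := by linarith
  have hg1 : g m = (1 - α₂ ^ m) / ((1 - α₂) * (1 - c₂ + c₂ * m)) := by
    rw [hg, Real.rpow_natCast]
  have hgpos : 0 < g m := by
    rw [hg1]
    exact div_pos (by linarith) (mul_pos hb hD)
  have hg2 : g ((m + m : ℕ) : ℝ) ≤ (1 + α₂ ^ m) * g m := by
    rw [hg1, hg, Real.rpow_natCast, pow_add, ← mul_div_assoc]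
    have : 1 - α₂ ^ m * α₂ ^ m = (1 + α₂ ^ m) * (1 - α₂ ^ m) := by ring
    rw [this]
    apply div_le_div_of_nonneg_left
    · exact mul_nonneg (by linarith) (by linarith)
    · exact mul_pos hb hD
    · apply mul_le_mul_of_nonneg_left _ hb.le
      push_cast
      nlinarith
  rw [hw, hw, em, div_one, h1, one_mul]
  nlinarith
end

section
/- Let 0.52 < α₁ < 0.8, 0.52 < α₂ < 0.8, 0 < c₁ < 1/3, 0 < c₂ < 1/5, and let M ≥ 16 be an even natural number. Define f(γ) = (1 − α₁^γ)/(1 − α₁ + c₁·α₁·(1 − α₁^γ) − c₁·γ·α₁^γ·(1 − α₁)) and g(γ) = (1 − α₂^γ)/((1 − α₂)·(1 − c₂ + c₂·γ)), and w(γ) = f(γ)·g(M/γ). Then w(M/2) > w(M). -/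
theorem aux_pow (a : ℝ) (h0 : 0 < a) (h1 : a < 1) (N : ℕ) :
    (N : ℝ) * a ^ N * (1 - a) ≤ a * (1 - a ^ N) := by
  induction N with
  | zero => simp
  | succ n ih =>
    have hx1 : a ^ n ≤ 1 := pow_le_one₀ h0.le h1.le
    rw [pow_succ]
    push_cast
    have h2 := mul_le_mul_of_nonneg_left ih h0.le
    have h3 : 0 ≤ a * (1 - a) * (1 - a ^ n) :=
      mul_nonneg (mul_nonneg h0.le (by linarith)) (by linarith)
    nlinarith

/-- Hybrid splitting (M/2, 2) beats step-level-only (M, 1): w(M/2) > w(M). -/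
theorem stmt_18 (α₁ α₂ c₁ c₂ : ℝ)
    (hα₁l : 0.52 < α₁) (hα₁u : α₁ < 0.8) (hα₂l : 0.52 < α₂) (hα₂u : α₂ < 0.8)
    (hc₁l : 0 < c₁) (hc₁u : c₁ < 1 / 3) (hc₂l : 0 < c₂) (hc₂u : c₂ < 1 / 5)
    (M : ℕ) (hM : 16 ≤ M) (hMe : Even M)
    (f g w : ℝ → ℝ)
    (hf : ∀ γ : ℝ, f γ =
      (1 - α₁ ^ γ) / (1 - α₁ + c₁ * α₁ * (1 - α₁ ^ γ) - c₁ * γ * α₁ ^ γ * (1 - α₁)))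
    (hg : ∀ γ : ℝ, g γ = (1 - α₂ ^ γ) / ((1 - α₂) * (1 - c₂ + c₂ * γ)))
    (hw : ∀ γ : ℝ, w γ = f γ * g ((M : ℝ) / γ)) :
    w ((M : ℝ) / 2) > w (M : ℝ) := by
  norm_num at hα₁l hα₁u hα₂l hα₂u
  obtain ⟨N, rfl⟩ := hMe
  have hN : 8 ≤ N := by omega
  have hNr : (8 : ℝ) ≤ N := by exact_mod_cast hN
  have h0 : 0 < α₁ := by linarith
  have h1 : α₁ < 1 := by linarith
  have e1 : (((N + N : ℕ) : ℝ)) / 2 = (N : ℝ) := by push_cast; ring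
  have e2 : (((N + N : ℕ) : ℝ)) / (N : ℝ) = 2 := by
    push_cast; field_simp; norm_num
  have e3 : (((N + N : ℕ) : ℝ)) / ((N + N : ℕ) : ℝ) = 1 := by
    apply div_self; push_cast; linarith
  have hD := aux_pow α₁ h0 h1 N
  have hx0 : 0 < α₁ ^ N := pow_pos h0 N
  have hx : α₁ ^ N < 1 / 5 := by
    calc α₁ ^ N ≤ α₁ ^ 8 := pow_le_pow_of_le_one h0.le h1.le hN
      _ ≤ (4 / 5) ^ 8 := pow_le_pow_left₀ h0.le (by linarith) 8
      _ < 1 / 5 := by norm_num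
  have g1 : g 1 = 1 := by
    rw [hg, Real.rpow_one]
    have : 1 - α₂ ≠ 0 := by linarith
    field_simp
    ring
  have g2 : g 2 = (1 + α₂) / (1 + c₂) := by
    rw [hg, Real.rpow_two]
    have : 1 - α₂ ≠ 0 := by linarith
    have h3 : 1 + c₂ ≠ 0 := by linarith
    have h4 : 1 - c₂ + c₂ * 2 ≠ 0 := by intro h; apply h3; linarith
    field_simp
    ring
  have hG : 1 + α₁ ^ N < g 2 := by
    rw [g2, lt_div_iff₀ (by linarith)]
    nlinarith
  rw [gt_iff_lt, hw, hw, e1, e2, e3, g1, mul_one, hf, hf, Real.rpow_natCast, Real.rpow_natCast,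
    pow_add]
  push_cast
  generalize g 2 = G at hG
  generalize α₁ ^ N = x at *
  generalize (N : ℝ) = n at *
  have hD1 : 0 < 1 - α₁ + c₁ * α₁ * (1 - x) - c₁ * n * x * (1 - α₁) := by
    have := mul_le_mul_of_nonneg_left hD hc₁l.le
    nlinarith
  have hD2 : 1 - α₁ + c₁ * α₁ * (1 - x) - c₁ * n * x * (1 - α₁) ≤
      1 - α₁ + c₁ * α₁ * (1 - x * x) - c₁ * (n + n) * (x * x) * (1 - α₁) := by
    have p1 : 0 ≤ c₁ * (α₁ * (x * (1 - x))) := by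
      have : 0 < 1 - x := by linarith
      positivity
    have p2 : 0 ≤ c₁ * (n * (x * ((1 - α₁) * (1 - 2 * x)))) := by
      have : 0 < 1 - 2 * x := by linarith
      have : 0 < 1 - α₁ := by linarith
      positivity
    linarith
  generalize 1 - α₁ + c₁ * α₁ * (1 - x) - c₁ * n * x * (1 - α₁) = D1 at *
  generalize 1 - α₁ + c₁ * α₁ * (1 - x * x) - c₁ * (n + n) * (x * x) * (1 - α₁) = D2 at *
  have hx1 : 0 < 1 - x := by linarith
  calc (1 - x * x) / D2 ≤ (1 - x * x) / D1 :=
        div_le_div_of_nonneg_left (by nlinarith) hD1 hD2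
    _ = (1 - x) / D1 * (1 + x) := by ring
    _ < (1 - x) / D1 * G := mul_lt_mul_of_pos_left hG (by positivity)
end
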